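/- Let m_χ(t) be any integer such that every undirected graph with chromatic number at least m_χ(t) contains K_t as a minor. Then every digraph D with dichromatic number at least 2·m_χ(t) − 1 contains the biorientation of K_t as a strong minor. -/

import Mathlib

/-- Strong connectivity of the subdigraph induced on `S` by the digraph with arc relation `A`:
every ordered pair of vertices of `S` is joined by a directed path inside `S`. -/
def SConnOn {V : Type*} (A : V → V → Prop) (S : Set V) : Prop :=
  ∀ u ∈ S, ∀ v ∈ S, Relation.ReflTransGen (fun x y => x ∈ S ∧ y ∈ S ∧ A x y) u v

/-- The subdigraph induced on `S` contains no directed cycle. -/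
def AcyclicOn {V : Type*} (A : V → V → Prop) (S : Set V) : Prop :=
  ¬ ∃ u v, u ∈ S ∧ v ∈ S ∧ A u v ∧
      Relation.ReflTransGen (fun x y => x ∈ S ∧ y ∈ S ∧ A x y) v u

/-- The induced subdigraph on `S` admits an acyclic `k`-coloring. -/
def DiColorableOn {V : Type*} (A : V → V → Prop) (S : Set V) (k : ℕ) : Prop :=
  ∃ f : V → Fin k, ∀ c : Fin k, AcyclicOn A (S ∩ {v | f v = c})

/-- The digraph `(V, A)` admits an acyclic `k`-coloring. -/
def DiColorable {V : Type*} (A : V → V → Prop) (k : ℕ) : Prop :=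
  DiColorableOn A Set.univ k

/-- The dichromatic number of the digraph `(V, A)`, as an extended natural number. -/
noncomputable def diChromaticNumber {V : Type*} (A : V → V → Prop) : ℕ∞ :=
  sInf {n : ℕ∞ | ∃ k : ℕ, n = (k : ℕ∞) ∧ DiColorable A k}

/-- The digraph `(V, A)` contains the digraph `(W, B)` as a strong minor: a subdigraph of it
is a strong `(W, B)`-minor model, i.e. there are pairwise disjoint nonempty branch sets,
each inducing a strongly connected subdigraph, with an arc from `X w₁` to `X w₂`
for every arc `(w₁, w₂)` of `B`. -/
def IsStrongMinor {V W : Type*} (A : V → V → Prop) (B : W → W → Prop) : Prop :=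
  ∃ X : W → Set V,
    (∀ w, (X w).Nonempty) ∧
    (∀ w₁ w₂, w₁ ≠ w₂ → Disjoint (X w₁) (X w₂)) ∧
    (∀ w, SConnOn A (X w)) ∧
    (∀ w₁ w₂, B w₁ w₂ → ∃ x ∈ X w₁, ∃ y ∈ X w₂, A x y)

/-- Connectivity of the subgraph of `G` induced on `S`. -/
def ConnOn {V : Type*} (G : SimpleGraph V) (S : Set V) : Prop :=
  ∀ u ∈ S, ∀ v ∈ S, Relation.ReflTransGen (fun x y => x ∈ S ∧ y ∈ S ∧ G.Adj x y) u v

/-- `G` contains the complete graph `K_t` as a minor: `t` pairwise disjoint nonempty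
connected branch sets with an edge between any two of them. -/
def HasCompleteMinor {V : Type*} (G : SimpleGraph V) (t : ℕ) : Prop :=
  ∃ X : Fin t → Set V,
    (∀ i, (X i).Nonempty) ∧
    (∀ i j, i ≠ j → Disjoint (X i) (X j)) ∧
    (∀ i, ConnOn G (X i)) ∧
    (∀ i j, i ≠ j → ∃ x ∈ X i, ∃ y ∈ X j, G.Adj x y)

universe u

abbrev Stp {V : Type*} (A : V → V → Prop) (S : Set V) : V → V → Prop :=
  fun x y => x ∈ S ∧ y ∈ S ∧ A x y

lemma stp_mono {V : Type*} {A : V → V → Prop} {S T : Set V} (h : S ⊆ T) {u v : V}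
    (w : Relation.ReflTransGen (Stp A S) u v) : Relation.ReflTransGen (Stp A T) u v :=
by
  induction w with
  | refl => exact .refl
  | tail _ hxy ih => exact ih.tail ⟨h hxy.1, h hxy.2.1, hxy.2.2⟩

lemma acyclicOn_mono {V : Type*} {A : V → V → Prop} {S T : Set V} (h : S ⊆ T)
    (hT : AcyclicOn A T) : AcyclicOn A S := by
  rintro ⟨u, v, hu, hv, ha, w⟩
  exact hT ⟨u, v, h hu, h hv, ha, stp_mono h w⟩

lemma walk_finite {V : Type*} {A : V → V → Prop} {S : Set V} {u v : V} (hu : u ∈ S)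
    (w : Relation.ReflTransGen (Stp A S) u v) :
    ∃ s : Finset V, (↑s : Set V) ⊆ S ∧ u ∈ s ∧ v ∈ s ∧
      Relation.ReflTransGen (Stp A (↑s : Set V)) u v := by
  classical
  induction w with
  | refl => exact ⟨{u}, by simpa using hu, by simp, by simp, .refl⟩
  | @tail b c _ hbc ih =>
    obtain ⟨s, hs, h1, h2, h3⟩ := ih
    refine ⟨insert c s, ?_, by simp [h1], by simp, ?_⟩
    · intro x hx
      simp only [Finset.coe_insert, Set.mem_insert_iff, Finset.mem_coe] at hx
      rcases hx with rfl | hx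
      · exact hbc.2.1
      · exact hs hx
    · refine (stp_mono (by simp) h3).tail ⟨by simp [h2], by simp, hbc.2.2⟩

lemma compactness {V : Type*} (A : V → V → Prop) (k : ℕ)
    (h : ∀ s : Finset V, DiColorableOn A (↑s : Set V) k) : DiColorable A k := by
  choose g hg using h
  obtain ⟨χ, hχ⟩ := Finset.rado_selection g
  refine ⟨χ, fun c => ?_⟩
  rintro ⟨u, v, hu, hv, ha, w⟩
  obtain ⟨s, hs, h1, h2, h3⟩ := walk_finite hv w
  obtain ⟨t, hst, ht⟩ := hχ s
  have hsub : (↑s : Set V) ⊆ ↑t ∩ {v | g t v = c} := by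
    intro x hx
    refine ⟨hst hx, ?_⟩
    have := (hs hx).2
    simp only [Set.mem_ofPred_eq] at this ⊢
    rw [← ht x hx, this]
  exact hg t c ⟨u, v, hsub h2, hsub h1, ha, stp_mono hsub h3⟩

lemma acyclicOn_of_rank {V : Type*} {A : V → V → Prop} {S : Set V} (r : V → ℕ)
    (h : ∀ u ∈ S, ∀ v ∈ S, A u v → r v < r u) : AcyclicOn A S := by
  rintro ⟨u, v, hu, hv, ha, w⟩
  have key : ∀ z, Relation.ReflTransGen (Stp A S) v z → r z ≤ r v := by
    intro z hz
    induction hz with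
    | refl => exact le_rfl
    | tail _ hbc ih => exact (h _ hbc.1 _ hbc.2.1 hbc.2.2).le.trans ih
  have := key u w
  have := h u hu v hv ha
  omega

/-- Gluing lemma: no excursion from `P` through `T` back to `P`. -/
lemma acyclicOn_union {V : Type*} {A : V → V → Prop} {P T : Set V}
    (hP : AcyclicOn A P) (hT : AcyclicOn A T)
    (hex : ¬ ∃ x ∈ P, ∃ p ∈ T, ∃ q ∈ T, ∃ y ∈ P,
      A x p ∧ Relation.ReflTransGen (Stp A T) p q ∧ A q y) : AcyclicOn A (P ∪ T) := by
  have key : ∀ x y, Relation.ReflTransGen (Stp A (P ∪ T)) x y → y ∈ P →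
      (x ∈ P → Relation.ReflTransGen (Stp A P) x y) ∧
      (x ∈ T → x ∈ P ∨ ∃ q ∈ T, ∃ z ∈ P, Relation.ReflTransGen (Stp A T) x q ∧ A q z) := by
    intro x y w hy
    induction w using Relation.ReflTransGen.head_induction_on with
    | refl => exact ⟨fun _ => .refl, fun _ => Or.inl hy⟩
    | @head a c hac _ ih =>
      have hcase : c ∈ P ∨ (c ∈ T ∧ c ∉ P) := by
        by_cases hc : c ∈ P
        · exact Or.inl hc
        · exact Or.inr ⟨hac.2.1.resolve_left hc, hc⟩
      refine ⟨fun ha => ?_, fun ha => ?_⟩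
      · rcases hcase with hc | ⟨hc, hc'⟩
        · exact (ih.1 hc).head ⟨ha, hc, hac.2.2⟩
        · obtain ⟨q, hq, z, hz, w1, w2⟩ := (ih.2 hc).resolve_left hc'
          exact absurd ⟨a, ha, c, hc, q, hq, z, hz, hac.2.2, w1, w2⟩ hex
      · right
        rcases hcase with hc | ⟨hc, hc'⟩
        · exact ⟨a, ha, c, hc, .refl, hac.2.2⟩
        · obtain ⟨q, hq, z, hz, w1, w2⟩ := (ih.2 hc).resolve_left hc'
          exact ⟨q, hq, z, hz, w1.head ⟨ha, hc, hac.2.2⟩, w2⟩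
  have key2 : ∀ x y, Relation.ReflTransGen (Stp A (P ∪ T)) x y → x ∈ T →
      Relation.ReflTransGen (Stp A T) x y ∨
      ∃ p ∈ P, Relation.ReflTransGen (Stp A (P ∪ T)) x p ∧
        Relation.ReflTransGen (Stp A (P ∪ T)) p y := by
    intro x y w hx
    induction w with
    | refl => exact Or.inl .refl
    | @tail b c _ hbc ih =>
      rcases ih with ih | ⟨p, hp, w1, w2⟩
      · by_cases hb : b ∈ P
        · exact Or.inr ⟨b, hb, by assumption, Relation.ReflTransGen.single hbc⟩
        · by_cases hc : c ∈ P
          · exact Or.inr ⟨c, hc, Relation.ReflTransGen.tail (by assumption) hbc, .refl⟩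
          · exact Or.inl (ih.tail ⟨hbc.1.resolve_left hb, hbc.2.1.resolve_left hc, hbc.2.2⟩)
      · exact Or.inr ⟨p, hp, w1, w2.tail hbc⟩
  have noP : ∀ u v, u ∈ P → v ∈ P ∪ T → A u v →
      ¬ Relation.ReflTransGen (Stp A (P ∪ T)) v u := by
    intro u v hu hv ha w
    by_cases hvP : v ∈ P
    · exact hP ⟨u, v, hu, hvP, ha, (key _ _ w hu).1 hvP⟩
    · have hvT := hv.resolve_left hvP
      obtain ⟨q, hq, z, hz, w1, w2⟩ := ((key _ _ w hu).2 hvT).resolve_left hvP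
      exact hex ⟨u, hu, v, hvT, q, hq, z, hz, ha, w1, w2⟩
  rintro ⟨u, v, hu, hv, ha, w⟩
  by_cases hvP : v ∈ P
  · rcases Relation.ReflTransGen.cases_head (w.tail ⟨hu, hv, ha⟩) with h | ⟨c, hvc, w'⟩
    · rcases Relation.ReflTransGen.cases_head w with h | ⟨c, hvc, w'⟩
      · subst h
        exact noP _ _ hvP hv ha .refl
      · exact noP v c hvP hvc.2.1 hvc.2.2 (w'.tail ⟨hu, hv, ha⟩)
    · exact noP v c hvP hvc.2.1 hvc.2.2 w'
  · have hvT := hv.resolve_left hvP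
    by_cases huP : u ∈ P
    · exact noP u v huP hv ha w
    rcases key2 v u w hvT with h | ⟨p, hp, w1, w2⟩
    · exact hT ⟨u, v, hu.resolve_left huP, hvT, ha, h⟩
    · rcases Relation.ReflTransGen.cases_head w2 with h | ⟨c, hpc, w'⟩
      · exact huP (h ▸ hp)
      · exact noP p c hp hpc.2.1 hpc.2.2 ((w'.tail ⟨hu, hv, ha⟩).trans w1)

def Exc {V : Type*} (A : V → V → Prop) (X T : Set V) (n : ℕ) (p : ℕ → V) : Prop :=
  (∀ j ≤ n, p j ∈ T) ∧ (∀ j < n, A (p j) (p (j + 1))) ∧ (∃ x ∈ X, A x (p 0)) ∧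
    (∃ y ∈ X, A (p n) y)

lemma walk_fun {V : Type*} {A : V → V → Prop} {T : Set V} {u v : V} (hu : u ∈ T)
    (w : Relation.ReflTransGen (Stp A T) u v) :
    ∃ n, ∃ p : ℕ → V, p 0 = u ∧ p n = v ∧ (∀ j ≤ n, p j ∈ T) ∧
      (∀ j < n, A (p j) (p (j + 1))) := by
  induction w with
  | refl => exact ⟨0, fun _ => u, rfl, rfl, fun _ _ => hu, by simp⟩
  | @tail b c _ hbc ih =>
    obtain ⟨n, p, h0, hn, hT, hA⟩ := ih
    refine ⟨n + 1, fun j => if j ≤ n then p j else c, by simp [h0], by simp, ?_, ?_⟩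
    · intro j hj
      dsimp only
      split_ifs with h
      · exact hT j h
      · exact hbc.2.1
    · intro j hj
      have hj' : j ≤ n := by omega
      by_cases h : j + 1 ≤ n
      · simp only [hj', h, if_true]
        exact hA j (by omega)
      · have : j = n := by omega
        subst this
        simpa [hn] using hbc.2.2

lemma extend_part {V : Type*} {A : V → V → Prop} (hl : ∀ v, ¬ A v v) {X T : Set V}
    (hdis : Disjoint X T) (hX : SConnOn A X) (hX2 : DiColorableOn A X 2)
    (hsingle : ¬ ∃ p ∈ T, (∃ x ∈ X, A x p) ∧ ∃ y ∈ X, A p y)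
    (hex : ∃ x ∈ X, ∃ p ∈ T, ∃ q ∈ T, ∃ y ∈ X,
      A x p ∧ Relation.ReflTransGen (Stp A T) p q ∧ A q y) :
    ∃ Y, X ⊂ Y ∧ Y ⊆ X ∪ T ∧ SConnOn A Y ∧ DiColorableOn A Y 2 := by
  classical
  have hE : ∃ n, ∃ p, Exc A X T n p := by
    obtain ⟨x, hx, p, hp, q, hq, y, hy, a1, w, a2⟩ := hex
    obtain ⟨n, f, h0, hn, h1, h2⟩ := walk_fun hp w
    exact ⟨n, f, h1, h2, ⟨x, hx, h0 ▸ a1⟩, ⟨y, hy, hn ▸ a2⟩⟩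
  have hmin : ∀ k, k < Nat.find hE → ∀ p, ¬ Exc A X T k p := by
    intro k hk p hp
    exact Nat.find_min hE hk ⟨p, hp⟩
  obtain ⟨p, hT, hA, hin, hout⟩ := Nat.find_spec hE
  generalize Nat.find hE = n at *
  have hin' : ∀ j ≤ n, (∃ x ∈ X, A x (p j)) → j = 0 := by
    intro j hj hx
    by_contra hne
    refine hmin (n - j) (by omega) (fun k => p (j + k)) ⟨?_, ?_, by simpa using hx, ?_⟩
    · intro k hk; exact hT _ (by omega)
    · intro k hk; exact hA (j + k) (by omega)
    · simpa [Nat.add_sub_cancel' hj] using hout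
  have hout' : ∀ j ≤ n, (∃ y ∈ X, A (p j) y) → j = n := by
    intro j hj hy
    by_contra hne
    exact hmin j (by omega) p ⟨fun k hk => hT k (by omega), fun k hk => hA k (by omega), hin, hy⟩
  have hfwd : ∀ i j, i < j → j ≤ n → A (p i) (p j) → j = i + 1 := by
    intro i j hij hj ha
    by_contra hne
    refine hmin (n - (j - i - 1)) (by omega)
      (fun k => if k ≤ i then p k else p (k + (j - i - 1))) ⟨?_, ?_, by simpa using hin, ?_⟩
    · intro k hk
      dsimp only
      split_ifs
      · exact hT _ (by omega)
      · exact hT _ (by omega)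
    · intro k hk
      by_cases h1 : k + 1 ≤ i
      · simp only [h1, (by omega : k ≤ i), if_true]
        exact hA k (by omega)
      · by_cases h2 : k ≤ i
        · have : k = i := by omega
          subst this
          simp only [le_refl, if_true, h1, if_false]
          rwa [(by omega : k + 1 + (j - k - 1) = j)]
        · simp only [h1, h2, if_false]
          rw [(by omega : k + 1 + (j - i - 1) = (k + (j - i - 1)) + 1)]
          exact hA _ (by omega)
    · dsimp only
      rw [if_neg (by omega), (by omega : n - (j - i - 1) + (j - i - 1) = n)]
      exact hout
  have hn : n ≠ 0 := by
    rintro rfl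
    exact hsingle ⟨p 0, hT 0 le_rfl, hin, hout⟩
  have hne : ∀ i j, i < j → j ≤ n → p i ≠ p j := by
    intro i j hij hj he
    rcases hj.lt_or_eq with h | rfl
    · have := hA j h
      rw [← he] at this
      have := hfwd i (j + 1) (by omega) h this
      omega
    · have := hout' i (by omega) (by rw [he]; exact hout)
      omega
  have hinj : Set.InjOn p (Set.Iic n) := by
    intro i hi j hj he
    rcases lt_trichotomy i j with h | h | h
    · exact absurd he (hne i j h hj)
    · exact h
    · exact absurd he.symm (hne j i h hi)
  obtain ⟨r, hr⟩ : ∃ r : V → ℕ, ∀ j ≤ n, r (p j) = j :=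
    ⟨Function.invFunOn p (Set.Iic n), fun j hj => hinj.leftInvOn_invFunOn hj⟩
  have hpX : ∀ j ≤ n, p j ∉ X := fun j hj h => Set.disjoint_left.1 hdis h (hT j hj)
  let Y : Set V := X ∪ p '' Set.Iic n
  have hXY : X ⊆ Y := Set.subset_union_left
  have hpY : ∀ j ≤ n, p j ∈ Y := fun j hj => Or.inr ⟨j, hj, rfl⟩
  refine ⟨Y, ⟨hXY, fun h => hpX 0 (by omega) (h (hpY 0 (by omega)))⟩, ?_, ?_, ?_⟩
  · rintro v (hv | ⟨j, hj, rfl⟩)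
    · exact Or.inl hv
    · exact Or.inr (hT j hj)
  · obtain ⟨x, hx, hxp⟩ := hin
    obtain ⟨y, hy, hpy⟩ := hout
    have w1 : ∀ j ≤ n, Relation.ReflTransGen (Stp A Y) x (p j) := by
      intro j
      induction j with
      | zero => exact fun _ => Relation.ReflTransGen.single ⟨hXY hx, hpY 0 (by omega), hxp⟩
      | succ j ih =>
        intro hj
        exact (ih (by omega)).tail ⟨hpY _ (by omega), hpY _ hj, hA j (by omega)⟩
    have w2 : ∀ d ≤ n, Relation.ReflTransGen (Stp A Y) (p (n - d)) y := by
      intro d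
      induction d with
      | zero => exact fun _ => Relation.ReflTransGen.single ⟨hpY _ (by omega), hXY hy, hpy⟩
      | succ d ih =>
        intro hd
        refine (ih (by omega)).head ⟨hpY _ (by omega), hpY _ (by omega), ?_⟩
        have := hA (n - (d + 1)) (by omega)
        rwa [(by omega : n - (d + 1) + 1 = n - d)] at this
    have wto : ∀ u ∈ Y, Relation.ReflTransGen (Stp A Y) u x := by
      rintro u (hu | ⟨j, hj, rfl⟩)
      · exact stp_mono hXY (hX u hu x hx)
      · have := w2 (n - j) (by omega)
        rw [Nat.sub_sub_self hj] at this
        exact this.trans (stp_mono hXY (hX y hy x hx))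
    have wfrom : ∀ u ∈ Y, Relation.ReflTransGen (Stp A Y) x u := by
      rintro u (hu | ⟨j, hj, rfl⟩)
      · exact stp_mono hXY (hX x hx u hu)
      · exact w1 j hj
    exact fun u hu v hv => (wto u hu).trans (wfrom v hv)
  · obtain ⟨g, hg⟩ := hX2
    let h : V → Fin 2 := fun v => if v ∈ X then g v else ⟨r v % 2, by omega⟩
    refine ⟨h, fun c => ?_⟩
    let Q : Set V := {v | ∃ j ≤ n, p j = v ∧ j % 2 = c.val}
    have hsub : Y ∩ {v | h v = c} ⊆ (X ∩ {v | g v = c}) ∪ Q := by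
      rintro v ⟨hv | ⟨j, hj, rfl⟩, hc⟩
      · left
        refine ⟨hv, ?_⟩
        simpa [h, hv] using hc
      · right
        refine ⟨j, hj, rfl, ?_⟩
        have hc' : h (p j) = c := hc
        simp only [h, hpX j hj, if_false, hr j hj] at hc'
        rw [← hc']
    have hdec : ∀ u ∈ Q, ∀ v ∈ Q, A u v → r v < r u := by
      rintro u ⟨i, hi, rfl, hic⟩ v ⟨j, hj, rfl, hjc⟩ ha
      rw [hr i hi, hr j hj]
      by_contra hlt
      rcases (not_lt.1 hlt).lt_or_eq with h' | rfl
      · have := hfwd i j h' hj ha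
        omega
      · exact hl _ ha
    refine acyclicOn_mono hsub (acyclicOn_union (hg c) (acyclicOn_of_rank r hdec) ?_)
    rintro ⟨x, hx, a, ⟨i, hi, rfl, hic⟩, b, ⟨j, hj, rfl, hjc⟩, y, hy, h1, w, h2⟩
    have e1 := hin' i hi ⟨x, hx.1, h1⟩
    have e2 := hout' j hj ⟨y, hy.1, h2⟩
    have key : ∀ z, Relation.ReflTransGen (Stp A Q) (p i) z → r z ≤ r (p i) := by
      intro z hz
      induction hz with
      | refl => exact le_rfl
      | tail _ hbc ih => exact (hdec _ hbc.1 _ hbc.2.1 hbc.2.2).le.trans ih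
    have := key _ w
    rw [hr i hi, hr j hj] at this
    omega

/-- The greedy partition. -/
lemma greedy {V : Type*} (A : V → V → Prop) (hl : ∀ v, ¬ A v v) :
    ∀ (N : ℕ) (R : Finset V), R.card ≤ N → ∃ idx : V → ℕ,
      (∀ v ∈ R, idx v < N) ∧
      ∀ i, SConnOn A {v | v ∈ R ∧ idx v = i} ∧ DiColorableOn A {v | v ∈ R ∧ idx v = i} 2 ∧
        ∀ Y : Set V, {v | v ∈ R ∧ idx v = i}.Nonempty → {v | v ∈ R ∧ idx v = i} ⊂ Y →
          Y ⊆ {v | v ∈ R ∧ i ≤ idx v} → SConnOn A Y → ¬ DiColorableOn A Y 2 := by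
  classical
  intro N
  induction N with
  | zero =>
    intro R hR
    have : R = ∅ := by simpa using hR
    subst this
    refine ⟨fun _ => 0, by simp, fun i => ⟨by simp [SConnOn], ⟨fun _ => 0, ?_⟩, by simp⟩⟩
    intro c
    simp [AcyclicOn]
  | succ N ih =>
    intro R hR
    by_cases hemp : R = ∅
    · obtain ⟨idx, h1, h2⟩ := ih R (by simp [hemp])
      exact ⟨idx, fun v hv => (h1 v hv).trans (by omega), h2⟩
    obtain ⟨x0, hx0⟩ := Finset.nonempty_iff_ne_empty.2 hemp
    let F : Finset (Finset V) := R.powerset.filter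
      (fun X => X.Nonempty ∧ SConnOn A (↑X : Set V) ∧ DiColorableOn A (↑X : Set V) 2)
    have hF : F.Nonempty := by
      refine ⟨{x0}, ?_⟩
      simp only [F, Finset.mem_filter, Finset.mem_powerset, Finset.singleton_subset_iff]
      refine ⟨hx0, by simp, ?_, fun _ => 0, fun c => ?_⟩
      · intro u hu v hv
        simp only [Finset.coe_singleton, Set.mem_singleton_iff] at hu hv
        subst hu; subst hv; exact .refl
      · rintro ⟨u, v, hu, hv, ha, -⟩
        have hu := hu.1
        have hv := hv.1
        simp only [Finset.coe_singleton, Set.mem_singleton_iff] at hu hv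
        subst hu; subst hv; exact hl _ ha
    obtain ⟨X, hXF, hXmax⟩ := Finset.exists_max_image F Finset.card hF
    simp only [F, Finset.mem_filter, Finset.mem_powerset] at hXF
    obtain ⟨hXR, hXne, hXs, hX2⟩ := hXF
    have hcard : (R \ X).card ≤ N := by
      have := Finset.card_sdiff_add_card_eq_card hXR
      have := hXne.card_pos
      omega
    obtain ⟨idx, h1, h2⟩ := ih (R \ X) hcard
    let idx' : V → ℕ := fun v => if v ∈ X then 0 else idx v + 1
    have e0 : {v | v ∈ R ∧ idx' v = 0} = (↑X : Set V) := by
      ext v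
      by_cases hv : v ∈ X
      · simp [idx', hv, hXR hv]
      · simp [idx', hv]
    have e1 : ∀ i, {v | v ∈ R ∧ idx' v = i + 1} = {v | v ∈ R \ X ∧ idx v = i} := by
      intro i
      ext v
      by_cases hv : v ∈ X <;> simp [idx', hv]
    have e2 : ∀ i, {v | v ∈ R ∧ i + 1 ≤ idx' v} = {v | v ∈ R \ X ∧ i ≤ idx v} := by
      intro i
      ext v
      by_cases hv : v ∈ X <;> simp [idx', hv]
    refine ⟨idx', ?_, ?_⟩
    · intro v hv
      by_cases hvX : v ∈ X
      · simp [idx', hvX]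
      · have := h1 v (by simp [hv, hvX])
        simp only [idx', hvX, if_false]
        omega
    · intro i
      rcases i with _ | i
      · rw [e0]
        refine ⟨hXs, hX2, ?_⟩
        intro Y _ hXY hYR hYs hY2
        have hfin : Y.Finite := R.finite_toSet.subset (fun v hv => (hYR hv).1)
        obtain ⟨Z, rfl⟩ := hfin.exists_finset_coe
        have hXZ : X ⊂ Z := by exact_mod_cast hXY
        have := hXmax Z (by
          simp only [F, Finset.mem_filter, Finset.mem_powerset]
          exact ⟨fun v hv => (hYR hv).1, hXne.mono hXZ.1, hYs, hY2⟩)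
        have := Finset.card_lt_card hXZ
        omega
      · rw [e1, e2]
        exact h2 i

lemma finite_case {V : Type u} (A : V → V → Prop) (hl : ∀ v, ¬ A v v) (R : Finset V)
    (t k : ℕ) (hk : 0 < k)
    (hm : ∀ (W : Type u) (G : SimpleGraph W), HasCompleteMinor G t ∨ G.Colorable k)
    (hR : ¬ DiColorableOn A (↑R : Set V) (k * 2)) :
    IsStrongMinor A (fun a b : Fin t => a ≠ b) := by
  classical
  obtain ⟨idx, hN, hpart⟩ := greedy A hl R.card R le_rfl
  let X : ℕ → Set V := fun i => {v | v ∈ R ∧ idx v = i}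
  have hX : ∀ i, SConnOn A (X i) := fun i => (hpart i).1
  let W : Type u := ULift.{u} {i : ℕ // (X i).Nonempty}
  let G : SimpleGraph W :=
    { Adj := fun a b => a ≠ b ∧ (∃ x ∈ X a.down.1, ∃ y ∈ X b.down.1, A x y) ∧
        (∃ x ∈ X b.down.1, ∃ y ∈ X a.down.1, A x y)
      symm := ⟨fun a b h => ⟨h.1.symm, h.2.2, h.2.1⟩⟩
      loopless := ⟨fun a h => h.1 rfl⟩ }
  rcases hm W G with ⟨B, hne, hdis, hcon, hadj⟩ | hC
  · have hXZ : ∀ i, ∀ w ∈ B i, X w.down.1 ⊆ {v | ∃ w ∈ B i, v ∈ X w.down.1} :=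
      fun i w hw v hv => ⟨w, hw, hv⟩
    refine ⟨fun i => {v | ∃ w ∈ B i, v ∈ X w.down.1}, ?_, ?_, ?_, ?_⟩
    · intro i
      obtain ⟨w, hw⟩ := hne i
      obtain ⟨v, hv⟩ := w.down.2
      exact ⟨v, w, hw, hv⟩
    · intro i j hij
      rw [Set.disjoint_left]
      rintro v ⟨w, hw, hv⟩ ⟨w', hw', hv'⟩
      have : w = w' := by
        apply ULift.ext
        apply Subtype.ext
        exact hv.2.symm.trans hv'.2
      subst this
      exact Set.disjoint_left.1 (hdis i j hij) hw hw'
    · rintro i u ⟨a, ha, hu⟩ v ⟨b, hb, hv⟩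
      have := hcon i a ha b hb
      clear hb
      induction this generalizing v with
      | refl => exact stp_mono (hXZ i a ha) (hX _ u hu v hv)
      | @tail c d _ hcd ih =>
        obtain ⟨hc, hd, -, ⟨x, hx, y, hy, hxy⟩, -⟩ := hcd
        exact ((ih x hx).tail ⟨hXZ i c hc hx, hXZ i d hd hy, hxy⟩).trans
          (stp_mono (hXZ i d hd) (hX _ y hy v hv))
    · intro i j hij
      obtain ⟨a, ha, b, hb, -, ⟨x, hx, y, hy, hxy⟩, -⟩ := hadj i j hij
      exact ⟨x, ⟨a, ha, hx⟩, y, ⟨b, hb, hy⟩, hxy⟩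
  · exfalso
    obtain ⟨C⟩ := hC
    apply hR
    choose g hg using fun i => (hpart i).2.1
    let C' : ℕ → Fin k := fun i => if h : (X i).Nonempty then C ⟨⟨i, h⟩⟩ else ⟨0, hk⟩
    let f : V → Fin (k * 2) := fun v => finProdFinEquiv (C' (idx v), g (idx v) v)
    refine ⟨f, fun c => ?_⟩
    let S : Set V := ↑R ∩ {v | f v = c}
    have hS : ∀ u ∈ S, ∀ v ∈ S, C' (idx u) = C' (idx v) ∧ g (idx u) u = g (idx v) v := by
      intro u hu v hv
      have : f u = f v := hu.2.trans hv.2.symm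
      have := finProdFinEquiv.injective this
      exact Prod.ext_iff.1 this
    have main : ∀ d i, R.card ≤ i + d → AcyclicOn A (S ∩ {v | i ≤ idx v}) := by
      intro d
      induction d with
      | zero =>
        rintro i hi ⟨u, v, hu, -⟩
        have := hN u hu.1.1
        have : i ≤ idx u := hu.2
        omega
      | succ d ih =>
        intro i hi
        have hT := ih (i + 1) (by omega)
        have hsub : S ∩ {v | i ≤ idx v} ⊆
            (S ∩ {v | idx v = i}) ∪ (S ∩ {v | i + 1 ≤ idx v}) := by
          rintro v ⟨hv, hiv⟩
          rcases (show i ≤ idx v from hiv).lt_or_eq with h | h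
          · exact Or.inr ⟨hv, h⟩
          · exact Or.inl ⟨hv, h.symm⟩
        refine acyclicOn_mono hsub (acyclicOn_union ?_ hT ?_)
        · by_cases hemp : (S ∩ {v | idx v = i}).Nonempty
          · obtain ⟨z, hz, hzi⟩ := hemp
            have hzi : idx z = i := hzi
            refine acyclicOn_mono ?_ (hg i (g i z))
            rintro v ⟨hv, hvi⟩
            have hvi : idx v = i := hvi
            refine ⟨⟨hv.1, hvi⟩, ?_⟩
            have := (hS v hv z hz).2
            rw [hvi, hzi] at this
            exact this
          · rintro ⟨u, v, hu, -⟩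
            exact hemp ⟨u, hu⟩
        · rintro ⟨x, hx, p, hp, q, hq, y, hy, h1, w, h2⟩
          have hxX : x ∈ X i := ⟨hx.1.1, hx.2⟩
          obtain ⟨Y, hXY, hYs, hYc, hY2⟩ := extend_part (A := A) hl
            (X := X i) (T := S ∩ {v | i + 1 ≤ idx v})
            (by
              rw [Set.disjoint_left]
              rintro v hv ⟨-, hv'⟩
              have a1 : idx v = i := hv.2
              have a2 : i + 1 ≤ idx v := hv'
              omega) (hX i) (hpart i).2.1
            (by
              rintro ⟨z, hz, ⟨a, ha, haz⟩, b, hb, hzb⟩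
              have hzi : i + 1 ≤ idx z := hz.2
              have hzX : z ∈ X (idx z) := ⟨hz.1.1, rfl⟩
              have hni : (X i).Nonempty := ⟨x, hxX⟩
              have hnz : (X (idx z)).Nonempty := ⟨z, hzX⟩
              have had : G.Adj ⟨⟨i, hni⟩⟩ ⟨⟨idx z, hnz⟩⟩ := by
                refine ⟨?_, ⟨a, ha, z, hzX, haz⟩, ⟨z, hzX, b, hb, hzb⟩⟩
                intro he
                have : i = idx z := congrArg (fun w : W => w.down.1) he
                omega
              have hcol := (hS x hx.1 z hz.1).1
              rw [show idx x = i from hx.2] at hcol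
              simp only [C', hni, hnz, dif_pos] at hcol
              exact C.valid had hcol)
            ⟨x, hxX, p, hp, q, hq, y, ⟨hy.1.1, hy.2⟩, h1, w, h2⟩
          refine (hpart i).2.2 Y ⟨x, hxX⟩ hXY ?_ hYc hY2
          intro v hv
          rcases hYs hv with h | h
          · exact ⟨h.1, h.2.ge⟩
          · exact ⟨h.1.1, (Nat.le_succ i).trans h.2⟩
    refine acyclicOn_mono ?_ (main R.card 0 (by omega))
    intro v hv
    exact ⟨hv, Nat.zero_le _⟩

/-- Let `m` be any integer such that every undirected graph with chromatic
number at least `m` contains `K_t` as a minor. Then every (loopless) digraph with dichromatic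
number at least `2m - 1` contains the biorientation of `K_t` as a strong minor. -/
theorem strongMinor_of_dichromatic_ge (t m : ℕ)
    (hm : ∀ (W : Type u) (G : SimpleGraph W),
      (m : ℕ∞) ≤ G.chromaticNumber → HasCompleteMinor G t)
    {V : Type u} (A : V → V → Prop) (hloopless : ∀ v, ¬ A v v)
    (hD : ((2 * m - 1 : ℕ) : ℕ∞) ≤ diChromaticNumber A) :
    IsStrongMinor A (fun a b : Fin t => a ≠ b) := by
  rcases Nat.lt_or_ge m 2 with h2 | h2
  · have ht : t ≤ 1 := by
      obtain ⟨X, hne, hdis, -, -⟩ := hm PUnit.{u+1} ⊥ (by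
        have : (1 : ℕ∞) ≤ (⊥ : SimpleGraph PUnit.{u+1}).chromaticNumber := by
          rw [SimpleGraph.chromaticNumber_bot]
        refine le_trans ?_ this
        exact_mod_cast (by omega : m ≤ 1))
      by_contra hlt
      obtain ⟨a, ha⟩ := hne ⟨0, by omega⟩
      obtain ⟨b, hb⟩ := hne ⟨1, by omega⟩
      exact Set.disjoint_left.1 (hdis ⟨0, by omega⟩ ⟨1, by omega⟩ (by simp)) ha hb
    have hV : t = 0 ∨ Nonempty V := by
      by_contra hcon
      push Not at hcon
      obtain ⟨ht0, hV⟩ := hcon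
      rcases Nat.eq_zero_or_pos m with rfl | hpos
      · obtain ⟨X, hne, -⟩ := hm V ⊥ (by simp)
        obtain ⟨v, -⟩ := hne ⟨0, by omega⟩
        exact hV.elim v
      · have : diChromaticNumber A ≤ ((0 : ℕ) : ℕ∞) :=
          sInf_le ⟨0, rfl, fun v => hV.elim v, fun c => c.elim0⟩
        have := hD.trans this
        have : 2 * m - 1 ≤ 0 := by exact_mod_cast this
        omega
    rcases hV with rfl | ⟨⟨v⟩⟩
    · exact ⟨fun _ => ∅, fun i => i.elim0, fun i => i.elim0, fun i => i.elim0, fun i => i.elim0⟩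
    · have hs : ∀ a b : Fin t, a = b := fun a b => by ext; omega
      refine ⟨fun _ => {v}, fun _ => by simp, fun a b h => absurd (hs a b) h, ?_,
        fun a b h => absurd (hs a b) h⟩
      rintro _ a rfl b rfl
      exact .refl
  · have hnc : ¬ DiColorable A ((m - 1) * 2) := by
      intro hc
      have : diChromaticNumber A ≤ (((m - 1) * 2 : ℕ) : ℕ∞) := sInf_le ⟨_, rfl, hc⟩
      have := hD.trans this
      have : 2 * m - 1 ≤ (m - 1) * 2 := by exact_mod_cast this
      omega
    have hfin : ∃ R : Finset V, ¬ DiColorableOn A (↑R : Set V) ((m - 1) * 2) := by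
      by_contra hcon
      push Not at hcon
      exact hnc (compactness A _ hcon)
    obtain ⟨R, hR⟩ := hfin
    refine finite_case A hloopless R t (m - 1) (by omega) (fun W G => ?_) hR
    by_cases hG : (m : ℕ∞) ≤ G.chromaticNumber
    · exact Or.inl (hm W G hG)
    · right
      rw [← SimpleGraph.chromaticNumber_le_iff_colorable]
      have h' : G.chromaticNumber < (m : ℕ∞) := not_le.1 hG
      have he : (m : ℕ∞) = ((m - 1 : ℕ) : ℕ∞) + 1 := by
        exact_mod_cast (by omega : m = m - 1 + 1)
      rw [he] at h'
      exact Order.le_of_lt_add_one h'
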